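/- arXiv:2010.06730 — 2 statements merged into one kernel-verified Lean document; each statement's English description precedes it below -/
import Mathlib

section
/- Let {S(t)} be a continuous semigroup on a Hausdorff space X, B a closed positively invariant set which is a normal space, and K a compact metrizable subset of X attracting every point of B. Then for any continuous bounded φ : B → ℝ, the set P_inv(B∩K) of invariant probability measures carried by B∩K is nonempty and max_{u₀∈B} limsup_{T→∞} (1/T)∫₀^T φ(S(t)u₀) dt = max_{μ∈P_inv(B∩K)} ∫ φ dμ. -/
open MeasureTheory Filter

namespace KB
open Topology BoundedContinuousFunction

/-- Time average, rescaled to `[0,1]`. -/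
noncomputable def avg {Y : Type*} [TopologicalSpace Y] (σ : ℝ → C(Y, Y)) (T : ℝ) (u : Y)
    (f : Y →ᵇ ℝ) : ℝ := ∫ r in (0:ℝ)..1, f (σ (T * r) u)

/-- Invariant positive normalized functionals carried by `C`. -/
structure Good {Y : Type*} [TopologicalSpace Y] (σ : ℝ → C(Y, Y)) (C : Set Y)
    (L : (Y →ᵇ ℝ) → ℝ) : Prop where
  add : ∀ f g, L (f + g) = L f + L g
  smul : ∀ (c : ℝ) f, L (c • f) = c * L f
  nonneg : ∀ f : Y →ᵇ ℝ, (∀ x, 0 ≤ f x) → 0 ≤ L f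
  one : L (BoundedContinuousFunction.const Y (1:ℝ)) = 1
  inv : ∀ t ≥ (0:ℝ), ∀ f : Y →ᵇ ℝ, L (f.compContinuous (σ t)) = L f
  zero : ∀ f : Y →ᵇ ℝ, (∀ x ∈ C, f x = 0) → L f = 0
  bd : ∀ f : Y →ᵇ ℝ, |L f| ≤ ‖f‖

variable {Y : Type*} [TopologicalSpace Y] {σ : ℝ → C(Y, Y)} {C : Set Y}

lemma isCompact_good (σ : ℝ → C(Y, Y)) (C : Set Y) : IsCompact {L | Good σ C L} := by
  have hbox : IsCompact (Set.pi Set.univ fun f : Y →ᵇ ℝ => Set.Icc (-‖f‖) ‖f‖) :=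
    isCompact_univ_pi fun f => isCompact_Icc
  refine hbox.of_isClosed_subset ?_ ?_
  · have : {L | Good σ C L} = {L : (Y →ᵇ ℝ) → ℝ | (∀ f g, L (f + g) = L f + L g) ∧
        (∀ (c : ℝ) f, L (c • f) = c * L f) ∧ (∀ f : Y →ᵇ ℝ, (∀ x, 0 ≤ f x) → 0 ≤ L f) ∧
        (L (BoundedContinuousFunction.const Y (1:ℝ)) = 1) ∧
        (∀ t ≥ (0:ℝ), ∀ f : Y →ᵇ ℝ, L (f.compContinuous (σ t)) = L f) ∧
        (∀ f : Y →ᵇ ℝ, (∀ x ∈ C, f x = 0) → L f = 0) ∧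
        (∀ f : Y →ᵇ ℝ, |L f| ≤ ‖f‖)} := by
      ext L
      constructor
      · rintro ⟨a, b, c, d, e, f, g⟩
        exact ⟨a, b, c, d, e, f, g⟩
      · rintro ⟨a, b, c, d, e, f, g⟩
        exact ⟨a, b, c, d, e, f, g⟩
    rw [this]
    have ev : ∀ f : Y →ᵇ ℝ, Continuous fun L : (Y →ᵇ ℝ) → ℝ => L f := fun f => continuous_apply f
    simp only [Set.ofPred_and, Set.ofPred_forall]
    refine IsClosed.inter ?_ (IsClosed.inter ?_ (IsClosed.inter ?_ (IsClosed.inter ?_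
      (IsClosed.inter ?_ (IsClosed.inter ?_ ?_)))))
    · exact isClosed_iInter fun f => isClosed_iInter fun g =>
        isClosed_eq (ev _) ((ev _).add (ev _))
    · exact isClosed_iInter fun c => isClosed_iInter fun f =>
        isClosed_eq (ev _) (continuous_const.mul (ev _))
    · exact isClosed_iInter fun f => isClosed_iInter fun _ => isClosed_le continuous_const (ev _)
    · exact isClosed_eq (ev _) continuous_const
    · exact isClosed_iInter fun t => isClosed_iInter fun _ => isClosed_iInter fun f =>
        isClosed_eq (ev _) (ev _)
    · exact isClosed_iInter fun f => isClosed_iInter fun _ => isClosed_eq (ev _) continuous_const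
    · exact isClosed_iInter fun f => isClosed_le (ev _).abs continuous_const
  · intro L hL f _
    exact abs_le.1 (hL.bd f)

lemma cont_path (hσ : Continuous fun p : ℝ × Y => σ p.1 p.2) (f : Y →ᵇ ℝ) (T : ℝ) (u : Y) :
    Continuous fun r : ℝ => f (σ (T * r) u) :=
  f.continuous.comp (hσ.comp (by fun_prop : Continuous fun r : ℝ => (T * r, u)))

lemma cont_path1 (hσ : Continuous fun p : ℝ × Y => σ p.1 p.2) (f : Y →ᵇ ℝ) (u : Y) :
    Continuous fun r : ℝ => f (σ r u) :=
  f.continuous.comp (hσ.comp (by fun_prop : Continuous fun r : ℝ => (r, u)))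

lemma abs_avg_le (f : Y →ᵇ ℝ) (T : ℝ) (u : Y) : |avg σ T u f| ≤ ‖f‖ := by
  have := intervalIntegral.norm_integral_le_of_norm_le_const (a := 0) (b := 1)
    (f := fun r : ℝ => f (σ (T * r) u)) (C := ‖f‖) (fun x _ => f.norm_coe_le_norm _)
  simpa [avg] using this

lemma avg_eq (f : Y →ᵇ ℝ) {T : ℝ} (hT : 0 < T) (u : Y) :
    avg σ T u f = (1 / T) * ∫ t in (0:ℝ)..T, f (σ t u) := by
  have := intervalIntegral.integral_comp_mul_left (a := 0) (b := 1)
    (fun t => f (σ t u)) hT.ne'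
  simpa [avg] using this

lemma avg_inv (hσ : Continuous fun p : ℝ × Y => σ p.1 p.2)
    (hadd : ∀ t ≥ (0:ℝ), ∀ s ≥ (0:ℝ), ∀ x, σ (t + s) x = σ t (σ s x))
    (f : Y →ᵇ ℝ) {t : ℝ} (ht : 0 ≤ t) (u : Y) :
    Tendsto (fun T => avg σ T u (f.compContinuous (σ t)) - avg σ T u f) atTop (𝓝 0) := by
  have hb : ∀ᶠ T : ℝ in atTop,
      ‖avg σ T u (f.compContinuous (σ t)) - avg σ T u f‖ ≤ (2 * ‖f‖ * t) / T := by
    filter_upwards [eventually_gt_atTop 0] with T hT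
    have hii : ∀ a b : ℝ, IntervalIntegrable (fun r : ℝ => f (σ r u)) volume a b :=
      fun a b => (cont_path1 hσ f u).intervalIntegrable a b
    have h1 : ∫ s in (0:ℝ)..T, (f.compContinuous (σ t)) (σ s u) = ∫ s in t..(T + t), f (σ s u) := by
      have h2 := intervalIntegral.integral_comp_add_left (a := 0) (b := T)
        (fun s => f (σ s u)) t
      rw [add_zero, add_comm t T] at h2
      rw [← h2]
      refine intervalIntegral.integral_congr fun s hs => ?_
      rw [Set.uIcc_of_le hT.le] at hs
      simp [hadd t ht s hs.1]
    have h3 : (∫ s in t..(T + t), f (σ s u)) - ∫ s in (0:ℝ)..T, f (σ s u)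
        = (∫ s in T..(T + t), f (σ s u)) - ∫ s in (0:ℝ)..t, f (σ s u) := by
      have e1 := intervalIntegral.integral_add_adjacent_intervals (hii 0 t) (hii t (T + t))
      have e2 := intervalIntegral.integral_add_adjacent_intervals (hii 0 T) (hii T (T + t))
      linarith
    have b1 := intervalIntegral.norm_integral_le_of_norm_le_const (a := T) (b := T + t)
      (f := fun r : ℝ => f (σ r u)) (C := ‖f‖) (fun x _ => f.norm_coe_le_norm _)
    have b2 := intervalIntegral.norm_integral_le_of_norm_le_const (a := 0) (b := t)
      (f := fun r : ℝ => f (σ r u)) (C := ‖f‖) (fun x _ => f.norm_coe_le_norm _)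
    rw [avg_eq _ hT, avg_eq _ hT, h1, ← mul_sub, h3, norm_mul, one_div, norm_inv, Real.norm_of_nonneg hT.le,
      div_eq_inv_mul]
    gcongr
    refine (norm_sub_le _ _).trans ?_
    simp only [add_sub_cancel_left, sub_zero, abs_of_nonneg ht] at b1 b2
    linarith
  exact squeeze_zero_norm' hb (tendsto_const_nhds.div_atTop tendsto_id)

lemma avg_zero (hσ : Continuous fun p : ℝ × Y => σ p.1 p.2)
    (hattr : ∀ x, ∀ O : Set Y, IsOpen O → C ⊆ O → ∃ T : ℝ, ∀ t ≥ T, σ t x ∈ O)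
    (f : Y →ᵇ ℝ) (hf : ∀ x ∈ C, f x = 0) (u : Y) :
    Tendsto (fun T => avg σ T u f) atTop (𝓝 0) := by
  have h0 : Tendsto (fun t : ℝ => f (σ t u)) atTop (𝓝 0) := by
    rw [tendsto_def]
    intro s hs
    obtain ⟨O, hO, hOo, h0⟩ := mem_nhds_iff.1 hs
    obtain ⟨T, hT⟩ := hattr u (f ⁻¹' O) (hOo.preimage f.continuous) (fun x hx => by
      simp [hf x hx, h0])
    filter_upwards [eventually_ge_atTop T] with t ht using hO (hT t ht)
  have := intervalIntegral.tendsto_integral_filter_of_dominated_convergence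
    (μ := volume) (a := (0:ℝ)) (b := 1) (l := atTop) (F := fun T r => f (σ (T * r) u))
    (f := fun _ => (0:ℝ))
    (fun _ => ‖f‖) (Eventually.of_forall fun T => (cont_path hσ f T u).aestronglyMeasurable)
    (Eventually.of_forall fun T => ae_of_all _ fun r _ => f.norm_coe_le_norm _)
    (by simp) (ae_of_all _ fun r hr => by
      rw [Set.uIoc_of_le zero_le_one] at hr
      exact h0.comp (tendsto_id.atTop_mul_const hr.1))
  simpa [avg] using this

lemma exists_good (hσ : Continuous fun p : ℝ × Y => σ p.1 p.2)
    (hadd : ∀ t ≥ (0:ℝ), ∀ s ≥ (0:ℝ), ∀ x, σ (t + s) x = σ t (σ s x))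
    (hattr : ∀ x, ∀ O : Set Y, IsOpen O → C ⊆ O → ∃ T : ℝ, ∀ t ≥ T, σ t x ∈ O)
    (φ : Y →ᵇ ℝ) (u : Y) (c : ℝ) (hc : ∃ᶠ T in atTop, c ≤ avg σ T u φ) :
    ∃ L, Good σ C L ∧ c ≤ L φ := by
  have hne : (atTop ⊓ 𝓟 {T : ℝ | c ≤ avg σ T u φ}).NeBot := frequently_mem_iff_neBot.1 hc
  set V : Ultrafilter ℝ := Ultrafilter.of (atTop ⊓ 𝓟 {T : ℝ | c ≤ avg σ T u φ}) with hV
  have hVle : (V : Filter ℝ) ≤ atTop ⊓ 𝓟 {T : ℝ | c ≤ avg σ T u φ} := Ultrafilter.of_le _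
  have hVtop : (V : Filter ℝ) ≤ atTop := hVle.trans inf_le_left
  have hVc : ∀ᶠ T in (V : Filter ℝ), c ≤ avg σ T u φ :=
    le_principal_iff.1 (hVle.trans inf_le_right)
  have hlim : ∀ f : Y →ᵇ ℝ, ∃ l : ℝ, Tendsto (fun T => avg σ T u f) V (𝓝 l) := by
    intro f
    obtain ⟨l, _, hl⟩ := (isCompact_Icc (a := -‖f‖) (b := ‖f‖)).ultrafilter_le_nhds
      (V.map fun T => avg σ T u f) (by
        rw [le_principal_iff]
        exact Eventually.of_forall (f := (V : Filter ℝ)) fun T => abs_le.1 (abs_avg_le f T u))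
    exact ⟨l, hl⟩
  choose L hL using hlim
  have ii : ∀ (f : Y →ᵇ ℝ) (T : ℝ), IntervalIntegrable (fun r : ℝ => f (σ (T * r) u)) volume 0 1 :=
    fun f T => (cont_path hσ f T u).intervalIntegrable _ _
  refine ⟨L, ⟨?_, ?_, ?_, ?_, ?_, ?_, ?_⟩, ge_of_tendsto (hL φ) hVc⟩
  · intro f g
    refine tendsto_nhds_unique (hL (f + g)) (((hL f).add (hL g)).congr fun T => ?_)
    simp only [avg, BoundedContinuousFunction.coe_add, Pi.add_apply]
    rw [intervalIntegral.integral_add (ii f T) (ii g T)]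
  · intro a f
    refine tendsto_nhds_unique (hL (a • f)) (((hL f).const_mul a).congr fun T => ?_)
    simp [avg]
  · intro f hf
    exact ge_of_tendsto' (hL f) fun T => intervalIntegral.integral_nonneg zero_le_one
      fun r _ => hf _
  · refine tendsto_nhds_unique (hL _) ((tendsto_const_nhds (x := (1:ℝ))).congr fun T => ?_)
    simp [avg]
  · intro t ht f
    have h1 := (hL (f.compContinuous (σ t))).sub (hL f)
    have h2 := tendsto_nhds_unique h1 ((avg_inv hσ hadd f ht u).mono_left hVtop)
    linarith
  · intro f hf
    exact tendsto_nhds_unique (hL f) ((avg_zero hσ hattr f hf u).mono_left hVtop)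
  · intro f
    exact le_of_tendsto' (hL f).abs fun T => abs_avg_le f T u

variable [T2Space Y] [NormalSpace Y] [MeasurableSpace Y] [BorelSpace Y]

lemma riesz (hC : IsCompact C) {L : (Y →ᵇ ℝ) → ℝ} (hL : Good σ C L) :
    ∃ μ : Measure Y, IsProbabilityMeasure μ ∧ μ.InnerRegular ∧ μ Cᶜ = 0 ∧
      ∀ f : Y →ᵇ ℝ, ∫ x, f x ∂μ = L f := by
  have : CompactSpace C := isCompact_iff_compactSpace.mp hC
  have hext : ∀ g : CompactlySupportedContinuousMap C ℝ, ∃ f : Y →ᵇ ℝ, ∀ x : C, f x = g x := by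
    intro g
    obtain ⟨f, _, hf⟩ := BoundedContinuousFunction.exists_norm_eq_domRestrict_eq_of_closed
      (BoundedContinuousFunction.mkOfCompact (g : C(C, ℝ))) hC.isClosed
    exact ⟨f, fun x => by simpa using congrArg (fun h => h x) hf⟩
  choose e he using hext
  have hneg : ∀ f, L (-f) = - L f := fun f => by
    have := hL.smul (-1) f
    have e1 : (-1 : ℝ) • f = -f := by
      ext x
      simp
    rw [e1] at this
    linarith
  have hcongr : ∀ f g : Y →ᵇ ℝ, (∀ x ∈ C, f x = g x) → L f = L g := by
    intro f g h
    have h1 := hL.zero (f + -g) (fun x hx => by simp [h x hx])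
    rw [hL.add, hneg] at h1
    linarith
  let Λ₀ : CompactlySupportedContinuousMap C ℝ →ₗ[ℝ] ℝ :=
    { toFun := fun g => L (e g)
      map_add' := fun g g' => by
        rw [← hL.add]
        exact hcongr _ _ fun x hx => by
          have h1 := he (g + g') ⟨x, hx⟩
          have h2 := he g ⟨x, hx⟩
          have h3 := he g' ⟨x, hx⟩
          simp only at h1 h2 h3
          simp [h1, h2, h3]
      map_smul' := fun a g => by
        simp only [RingHom.id_apply, smul_eq_mul]
        rw [← hL.smul]
        exact hcongr _ _ fun x hx => by
          have h1 := he (a • g) ⟨x, hx⟩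
          have h2 := he g ⟨x, hx⟩
          simp only at h1 h2
          simp [h1, h2] }
  let Λ : CompactlySupportedContinuousMap C ℝ →ₚ[ℝ] ℝ := PositiveLinearMap.mk₀ Λ₀ (by
    intro g hg
    have : L (e g) = L (e g ⊔ 0) := hcongr _ _ fun x hx => by
      have h2 := he g ⟨x, hx⟩
      have h3 : 0 ≤ g ⟨x, hx⟩ := hg ⟨x, hx⟩
      simp only at h2
      simp [h2, h3]
    change 0 ≤ L (e g)
    rw [this]
    exact hL.nonneg _ fun x => by simp)
  set m := RealRMK.rieszMeasure Λ with hm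
  have hIntEq : ∀ f : Y →ᵇ ℝ, ∫ x, f x ∂(m.map Subtype.val) = L f := by
    intro f
    rw [integral_map (by fun_prop) f.continuous.aestronglyMeasurable]
    let g : CompactlySupportedContinuousMap C ℝ :=
      ⟨⟨fun x => f x, by fun_prop⟩, HasCompactSupport.of_compactSpace _⟩
    have h1 := RealRMK.integral_rieszMeasure Λ g
    rw [← hm] at h1
    refine Eq.trans h1 (hcongr _ _ fun x hx => ?_)
    exact he g ⟨x, hx⟩
  refine ⟨m.map Subtype.val, ?_, Measure.InnerRegular.map_of_continuous (by fun_prop), ?_, hIntEq⟩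
  · have h1 := hIntEq (BoundedContinuousFunction.const Y 1)
    rw [hL.one] at h1
    simp only [BoundedContinuousFunction.const_apply, integral_const, smul_eq_mul, mul_one] at h1
    exact ⟨by
      rw [Measure.real, ENNReal.toReal_eq_one_iff] at h1
      exact h1⟩
  · rw [Measure.map_apply (by fun_prop) hC.measurableSet.compl]
    simp

lemma le_closed {μ ν : Measure Y} [IsFiniteMeasure μ] [IsFiniteMeasure ν] [ν.InnerRegular]
    (h : ∀ f : Y →ᵇ ℝ, ∫ x, f x ∂μ = ∫ x, f x ∂ν) {F : Set Y} (hF : IsClosed F) :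
    μ F ≤ ν F := by
  refine ENNReal.le_of_forall_pos_le_add fun ε hε _ => ?_
  obtain ⟨U, hFU, hU, hlt⟩ := F.exists_isOpen_lt_add (μ := ν) (measure_ne_top _ _)
    (ε := (ε : ENNReal)) (by simpa using hε.ne')
  refine le_trans ?_ hlt.le
  obtain ⟨f, hf0, hf1, hf⟩ := exists_bounded_zero_one_of_closed hU.isClosed_compl hF
    (Set.disjoint_compl_left_iff_subset.2 hFU)
  have i1 : μ.real F ≤ ∫ x, f x ∂μ := by
    rw [← integral_indicator_one hF.measurableSet]
    refine integral_mono ((integrable_const 1).indicator hF.measurableSet) (f.integrable μ) ?_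
    intro x
    by_cases hx : x ∈ F
    · simp [hx, hf1 hx]
    · simp [hx, (hf x).1]
  have i2 : ∫ x, f x ∂ν ≤ ν.real U := by
    rw [← integral_indicator_one hU.measurableSet]
    refine integral_mono (f.integrable ν) ((integrable_const 1).indicator hU.measurableSet) ?_
    intro x
    by_cases hx : x ∈ U
    · simp [hx, (hf x).2]
    · simp [hx, hf0 hx]
  have i3 : μ.real F ≤ ν.real U := i1.trans ((h f).le.trans i2)
  exact (ENNReal.toReal_le_toReal (measure_ne_top _ _) (measure_ne_top _ _)).1 i3

lemma ext_inner {μ ν : Measure Y} [IsProbabilityMeasure μ] [IsProbabilityMeasure ν]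
    [μ.InnerRegular] [ν.InnerRegular]
    (h : ∀ f : Y →ᵇ ℝ, ∫ x, f x ∂μ = ∫ x, f x ∂ν) : μ = ν := by
  refine ext_of_generate_finite _ (BorelSpace.measurable_eq.trans borel_eq_generateFrom_isClosed)
    isPiSystem_isClosed (fun F hF => ?_) (by simp)
  exact le_antisymm (le_closed h hF) (le_closed (fun f => (h f).symm) hF)

lemma good_of_measure (ν : Measure Y) [IsProbabilityMeasure ν] (hν : ν Cᶜ = 0)
    (hinv : ∀ t ≥ (0:ℝ), ν.map (σ t) = ν) : Good σ C fun f => ∫ x, f x ∂ν where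
  add f g := integral_add (f.integrable ν) (g.integrable ν)
  smul c f := integral_const_mul c _
  nonneg f hf := integral_nonneg hf
  one := by simp
  inv t ht f := by
    conv_rhs => rw [← hinv t ht]
    rw [integral_map (σ t).continuous.aemeasurable f.continuous.aestronglyMeasurable]
    rfl
  zero f hf := by
    refine integral_eq_zero_of_ae ?_
    have : ∀ᵐ x ∂ν, x ∈ C := hν
    filter_upwards [this] with x hx using hf x hx
  bd f := by
    simpa using f.norm_integral_le_norm ν

lemma fatou (hσ : Continuous fun p : ℝ × Y => σ p.1 p.2) {L : (Y →ᵇ ℝ) → ℝ} (hL : Good σ C L)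
    (μ : Measure Y) [IsProbabilityMeasure μ] (hμ : ∀ f : Y →ᵇ ℝ, ∫ x, f x ∂μ = L f)
    (φ : Y →ᵇ ℝ) : ∃ u : Y, ∀ c < L φ, ∃ᶠ T in atTop, c ≤ avg σ T u φ := by
  by_contra! hcon
  have hjoint : ∀ T : ℝ, Continuous fun p : ℝ × Y => φ (σ (T * p.1) p.2) := fun T =>
    φ.continuous.comp (hσ.comp (by fun_prop : Continuous fun p : ℝ × Y => (T * p.1, p.2)))
  have hmeas : ∀ T : ℝ, Measurable fun u => avg σ T u φ := by
    intro T
    simp only [avg, intervalIntegral.integral_of_le zero_le_one]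
    exact (StronglyMeasurable.integral_prod_right (f := fun u r => φ (σ (T * r) u))
      ((hjoint T).stronglyMeasurable.comp_measurable measurable_swap)).measurable
  have hIntEq : ∀ T ≥ (0:ℝ), ∫ u, avg σ T u φ ∂μ = L φ := by
    intro T hT
    simp only [avg]
    have hsw := intervalIntegral_integral_swap (a := 0) (b := 1) (μ := μ)
      (f := fun r u => φ (σ (T * r) u)) (by
        rw [Set.uIoc_of_le zero_le_one]
        refine Integrable.of_bound (hjoint T).aestronglyMeasurable ‖φ‖
          (ae_of_all _ fun p => φ.norm_coe_le_norm _))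
    rw [← hsw]
    have : ∀ r ∈ Set.uIcc (0:ℝ) 1, ∫ u, φ (σ (T * r) u) ∂μ = L φ := by
      intro r hr
      rw [Set.uIcc_of_le zero_le_one] at hr
      rw [← hL.inv (T * r) (mul_nonneg hT hr.1) φ, ← hμ]
      rfl
    rw [intervalIntegral.integral_congr this]
    simp
  have hge : ∀ T u, 0 ≤ avg σ T u φ + ‖φ‖ := fun T u => by
    linarith [(abs_le.1 (abs_avg_le (σ := σ) φ T u)).1]
  have hle : ∀ T u, avg σ T u φ ≤ ‖φ‖ := fun T u => (abs_le.1 (abs_avg_le (σ := σ) φ T u)).2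
  have hF := limsup_lintegral_le (μ := μ)
    (f := fun (n : ℕ) u => ENNReal.ofReal (avg σ n u φ + ‖φ‖))
    (fun _ => ENNReal.ofReal (‖φ‖ + ‖φ‖))
    (fun n => ((hmeas n).add_const _).ennreal_ofReal)
    (fun n => ae_of_all _ fun u => ENNReal.ofReal_le_ofReal (by linarith [hle n u])) (by simp)
  have hbi : ∀ T : ℝ, Integrable (fun u => avg σ T u φ) μ := fun T =>
    Integrable.of_bound (hmeas T).aestronglyMeasurable ‖φ‖ (ae_of_all _ fun u => abs_avg_le φ T u)
  have hlhs : ∀ n : ℕ, ∫⁻ u, ENNReal.ofReal (avg σ n u φ + ‖φ‖) ∂μ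
      = ENNReal.ofReal (L φ + ‖φ‖) := by
    intro n
    rw [← ofReal_integral_eq_lintegral_ofReal (f := fun u => avg σ n u φ + ‖φ‖) ((hbi n).add (integrable_const _))
      (ae_of_all _ fun u => hge n u), integral_add (hbi n) (integrable_const _),
      hIntEq n (Nat.cast_nonneg n)]
    simp
  simp only [hlhs, limsup_const] at hF
  have hlt : ∫⁻ u, limsup (fun n : ℕ => ENNReal.ofReal (avg σ n u φ + ‖φ‖)) atTop ∂μ
      < ∫⁻ _, ENNReal.ofReal (L φ + ‖φ‖) ∂μ := by
    have hpt : ∀ u, limsup (fun n : ℕ => ENNReal.ofReal (avg σ n u φ + ‖φ‖)) atTop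
        < ENNReal.ofReal (L φ + ‖φ‖) := by
      intro u
      obtain ⟨c, hc, hev⟩ := hcon u
      have hev : ∀ᶠ T in atTop, avg σ T u φ < c := by simpa [not_frequently] using hev
      have hevn : ∀ᶠ n : ℕ in atTop, avg σ n u φ < c :=
        tendsto_natCast_atTop_atTop.eventually hev
      obtain ⟨T, hT⟩ := hev.exists
      refine lt_of_le_of_lt (b := ENNReal.ofReal (c + ‖φ‖)) ?_ ?_
      · refine limsup_le_of_le (by isBoundedDefault) ?_
        filter_upwards [hevn] with n hn
        exact ENNReal.ofReal_le_ofReal (by linarith)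
      · rw [ENNReal.ofReal_lt_ofReal_iff] <;> linarith [hge T u]
    refine lintegral_strict_mono (IsProbabilityMeasure.ne_zero μ) aemeasurable_const ?_
      (ae_of_all _ hpt)
    refine ne_top_of_le_ne_top ?_ (lintegral_mono fun u => (hpt u).le)
    simp
  simp only [lintegral_const, measure_univ, mul_one] at hlt
  exact absurd hF (not_le.2 hlt)

lemma main [Nonempty Y] (hσ : Continuous fun p : ℝ × Y => σ p.1 p.2)
    (hadd : ∀ t ≥ (0:ℝ), ∀ s ≥ (0:ℝ), ∀ x, σ (t + s) x = σ t (σ s x))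
    (hC : IsCompact C)
    (hattr : ∀ x, ∀ O : Set Y, IsOpen O → C ⊆ O → ∃ T : ℝ, ∀ t ≥ T, σ t x ∈ O)
    (φ : Y →ᵇ ℝ) :
    ∃ (u : Y) (μ : Measure Y), IsProbabilityMeasure μ ∧ μ Cᶜ = 0 ∧
      (∀ t ≥ (0:ℝ), μ.map (σ t) = μ) ∧
      limsup (fun T => avg σ T u φ) atTop = ∫ x, φ x ∂μ ∧
      (∀ v, limsup (fun T => avg σ T v φ) atTop ≤ ∫ x, φ x ∂μ) ∧
      (∀ ν : Measure Y, IsProbabilityMeasure ν → ν Cᶜ = 0 → (∀ t ≥ (0:ℝ), ν.map (σ t) = ν) →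
        ∫ x, φ x ∂ν ≤ ∫ x, φ x ∂μ) := by
  obtain ⟨u0⟩ := ‹Nonempty Y›
  have hne : {L | Good σ C L}.Nonempty := by
    obtain ⟨L, hL, _⟩ := exists_good hσ hadd hattr φ u0 (-‖φ‖)
      (Eventually.frequently (Eventually.of_forall fun T => (abs_le.1 (abs_avg_le φ T u0)).1))
    exact ⟨L, hL⟩
  obtain ⟨L, hL, hmax⟩ := (isCompact_good σ C).exists_isMaxOn hne
    (continuous_apply φ).continuousOn
  have hmax : ∀ L', Good σ C L' → L' φ ≤ L φ := fun L' h => hmax h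
  obtain ⟨μ, hμ1, hμ2, hμ3, hμ4⟩ := riesz hC hL
  have hbdd : ∀ v, IsBoundedUnder (· ≤ ·) atTop (fun T => avg σ T v φ) := fun v =>
    isBoundedUnder_of ⟨‖φ‖, fun T => (abs_le.1 (abs_avg_le φ T v)).2⟩
  have hcob : ∀ v, IsCoboundedUnder (· ≤ ·) atTop (fun T => avg σ T v φ) := fun v =>
    (isBoundedUnder_of ⟨-‖φ‖, fun T => (abs_le.1 (abs_avg_le φ T v)).1⟩ :
      IsBoundedUnder (· ≥ ·) atTop (fun T => avg σ T v φ)).isCoboundedUnder_le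
  have hup : ∀ v, limsup (fun T => avg σ T v φ) atTop ≤ L φ := by
    intro v
    refine le_of_forall_lt fun c hc => ?_
    obtain ⟨c', h1, h2⟩ := exists_between hc
    obtain ⟨L', hL', hcL⟩ := exists_good hσ hadd hattr φ v c'
      ((frequently_lt_of_lt_limsup (hcob v) h2).mono fun T h => h.le)
    linarith [hmax L' hL']
  obtain ⟨u, hu⟩ := fatou hσ hL μ hμ4 φ
  refine ⟨u, μ, hμ1, hμ3, ?_, ?_, ?_, ?_⟩
  · intro t ht
    have : IsProbabilityMeasure (μ.map (σ t)) :=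
      Measure.isProbabilityMeasure_map (σ t).continuous.aemeasurable
    have : (μ.map (σ t)).InnerRegular :=
      Measure.InnerRegular.map_of_continuous (σ t).continuous
    refine ext_inner fun f => ?_
    rw [integral_map (σ t).continuous.aemeasurable f.continuous.aestronglyMeasurable, hμ4,
      ← hL.inv t ht, ← hμ4]
    rfl
  · rw [hμ4]
    refine le_antisymm (hup u) ?_
    refine le_of_forall_lt fun c hc => ?_
    obtain ⟨c', h1, h2⟩ := exists_between hc
    exact h1.trans_le (le_limsup_of_frequently_le (hu c' h2) (hbdd u))
  · rw [hμ4]; exact hup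
  · intro ν h1 h2 h3
    rw [hμ4]
    exact hmax _ (good_of_measure ν h2 h3)

end KB

/-- Let `S` be a continuous semigroup on a Hausdorff space `X`, `B` a closed positively
invariant set which is a normal space, and `K` a compact metrizable set attracting every
point of `B`. Then for `φ ∈ C_b(B)` the set of invariant probability measures carried by
`B ∩ K` is nonempty and
`max_{u₀∈B} limsup_{T→∞} (1/T)∫₀^T φ(S(t)u₀) dt = max_{μ∈P_inv(B∩K)} ∫ φ dμ`. -/
theorem stmt17 {X : Type*} [TopologicalSpace X] [T2Space X] [MeasurableSpace X] [BorelSpace X]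
    (S : ℝ → X → X) (hScont : Continuous fun p : ℝ × X => S p.1 p.2)
    (hS0 : ∀ x, S 0 x = x)
    (hSadd : ∀ t ≥ (0:ℝ), ∀ s ≥ (0:ℝ), ∀ x, S (t + s) x = S t (S s x))
    (B : Set X) (hBclosed : IsClosed B) (hBne : B.Nonempty)
    (hBinv : ∀ t ≥ (0:ℝ), ∀ x ∈ B, S t x ∈ B) [NormalSpace B]
    (K : Set X) (hK : IsCompact K) [TopologicalSpace.MetrizableSpace K]
    (hattr : ∀ x ∈ B, ∀ O : Set X, IsOpen O → K ⊆ O → ∃ T : ℝ, ∀ t ≥ T, S t x ∈ O)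
    (φ : X → ℝ) (hφc : ContinuousOn φ B) (hφb : ∃ M, ∀ x ∈ B, |φ x| ≤ M) :
    ∃ (u₀ : X) (μ : Measure X), u₀ ∈ B ∧ IsProbabilityMeasure μ ∧ μ ((B ∩ K)ᶜ) = 0 ∧
      (∀ t ≥ (0:ℝ), ∀ A : Set X, MeasurableSet A → μ (S t ⁻¹' A) = μ A) ∧
      limsup (fun T => (1 / T) * ∫ t in (0:ℝ)..T, φ (S t u₀)) atTop = ∫ x, φ x ∂μ ∧
      (∀ v ∈ B, limsup (fun T => (1 / T) * ∫ t in (0:ℝ)..T, φ (S t v)) atTop ≤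
        limsup (fun T => (1 / T) * ∫ t in (0:ℝ)..T, φ (S t u₀)) atTop) ∧
      (∀ ν : Measure X, IsProbabilityMeasure ν → ν ((B ∩ K)ᶜ) = 0 →
        (∀ t ≥ (0:ℝ), ∀ A : Set X, MeasurableSet A → ν (S t ⁻¹' A) = ν A) →
        ∫ x, φ x ∂ν ≤ ∫ x, φ x ∂μ) := by
  have hBm : MeasurableSet B := hBclosed.measurableSet
  obtain ⟨M, hM⟩ := hφb
  let σ : ℝ → C(B, B) := fun t =>
    ⟨fun x => ⟨S (max t 0) x, hBinv _ (le_max_right _ _) x x.2⟩, by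
      refine Continuous.subtype_mk ?_ _
      exact hScont.comp (by fun_prop : Continuous fun x : B => (max t 0, (x : X)))⟩
  have hσv : ∀ t ≥ (0:ℝ), ∀ x : B, ((σ t x : B) : X) = S t x := by
    intro t ht x
    change S (max t 0) x = S t x
    rw [max_eq_left ht]
  have hσ : Continuous fun p : ℝ × B => σ p.1 p.2 := by
    refine Continuous.subtype_mk ?_ _
    exact hScont.comp (by fun_prop : Continuous fun p : ℝ × B => (max p.1 0, (p.2 : X)))
  have hadd : ∀ t ≥ (0:ℝ), ∀ s ≥ (0:ℝ), ∀ x, σ (t + s) x = σ t (σ s x) := by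
    intro t ht s hs x
    apply Subtype.ext
    rw [hσv _ (add_nonneg ht hs), hσv _ ht, hσv _ hs, hSadd t ht s hs]
  let C : Set B := Subtype.val ⁻¹' K
  have hC : IsCompact C := by
    rw [Subtype.isCompact_iff, Subtype.image_preimage_coe]
    exact hK.inter_left hBclosed
  have hattr' : ∀ x, ∀ O : Set B, IsOpen O → C ⊆ O → ∃ T : ℝ, ∀ t ≥ T, σ t x ∈ O := by
    intro x O hO hCO
    obtain ⟨U, hU, rfl⟩ := isOpen_induced_iff.1 hO
    obtain ⟨T, hT⟩ := hattr x x.2 (U ∪ Bᶜ) (hU.union hBclosed.isOpen_compl) (by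
      intro y hy
      by_cases hyB : y ∈ B
      · exact Or.inl (hCO (show (⟨y, hyB⟩ : B) ∈ C from hy))
      · exact Or.inr hyB)
    refine ⟨max T 0, fun t ht => ?_⟩
    have ht0 : 0 ≤ t := (le_max_right _ _).trans ht
    rcases hT t ((le_max_left _ _).trans ht) with h | h
    · change ((σ t x : B) : X) ∈ U
      rwa [hσv t ht0]
    · exact absurd (hBinv t ht0 x x.2) h
  let ψ : BoundedContinuousFunction B ℝ := BoundedContinuousFunction.ofNormedAddCommGroup
    (fun x : B => φ x) (continuousOn_iff_continuous_domRestrict.1 hφc) M (fun x => hM x x.2)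
  have hψ : ∀ x : B, ψ x = φ x := fun _ => rfl
  have : Nonempty B := hBne.to_subtype
  have hlim : ∀ v : B, limsup (fun T => (1 / T) * ∫ t in (0:ℝ)..T, φ (S t v)) atTop
      = limsup (fun T => KB.avg σ T v ψ) atTop := by
    intro v
    refine limsup_congr ?_
    filter_upwards [eventually_gt_atTop 0] with T hT
    rw [KB.avg_eq _ hT]
    congr 1
    refine intervalIntegral.integral_congr fun t ht => ?_
    rw [Set.uIcc_of_le hT.le] at ht
    simp only [hψ, hσv t ht.1]
  obtain ⟨u, μ, hμ1, hμ2, hμ3, hu, hv, hν⟩ := KB.main hσ hadd hC hattr' ψ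
  have hemb : MeasurableEmbedding (Subtype.val : B → X) := MeasurableEmbedding.subtype_coe hBm
  have hIntEq : ∫ x, φ x ∂(μ.map Subtype.val) = ∫ x, ψ x ∂μ := hemb.integral_map φ
  refine ⟨u, μ.map Subtype.val, u.2, ?_, ?_, ?_, ?_, ?_, ?_⟩
  · exact Measure.isProbabilityMeasure_map (by fun_prop)
  · rw [hemb.map_apply]
    convert hμ2 using 2
    ext x
    simp [C]
  · intro t ht A hA
    rw [hemb.map_apply, hemb.map_apply]
    have hA' : MeasurableSet (Subtype.val ⁻¹' A : Set B) := measurable_subtype_coe hA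
    conv_rhs => rw [← hμ3 t ht]
    rw [Measure.map_apply (σ t).continuous.measurable hA']
    congr 1
    ext x
    simp [hσv t ht]
  · rw [hlim, hu, hIntEq]
  · intro v hvB
    rw [hlim u, hlim ⟨v, hvB⟩, hu]
    exact hv _
  · intro ν hν1 hν2 hν3
    have hνB : ∀ᵐ x ∂ν, x ∈ B := by
      have : ∀ᵐ x ∂ν, x ∈ B ∩ K := hν2
      exact this.mono fun x hx => hx.1
    have hmap : (ν.comap (Subtype.val : B → X)).map Subtype.val = ν := by
      rw [map_comap_subtype_coe hBm, Measure.restrict_eq_self_of_ae_mem hνB]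
    set ν' : Measure B := ν.comap (Subtype.val : B → X) with hν'
    have happ : ∀ A : Set X, ν' (Subtype.val ⁻¹' A) = ν A := by
      intro A
      rw [← hemb.map_apply, hmap]
    rw [hIntEq]
    have e1 : ∫ x, φ x ∂ν = ∫ x, ψ x ∂ν' := by
      conv_lhs => rw [← hmap]
      exact hemb.integral_map φ
    rw [e1]
    refine hν ν' ⟨?_⟩ ?_ ?_
    · have := happ Set.univ
      rw [Set.preimage_univ] at this
      rw [this, measure_univ]
    · rw [← hν2, ← happ]
      congr 1
      ext x
      simp [C]
    · intro t ht
      ext E hE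
      obtain ⟨A, hA, rfl⟩ := hE
      rw [Measure.map_apply (σ t).continuous.measurable (measurable_subtype_coe hA), happ,
        ← hν3 t ht A hA, ← happ]
      congr 1
      ext x
      simp [hσv t ht]
end

section
/- Let μ be a weak stationary statistical solution of the 3D Navier–Stokes equations carried by a bounded Borel set B in V. Then μ satisfies the mean energy equality ∫_H ψ′(‖u‖²_{L²}) ( ν‖∇u‖²_{L²} − ⟨f, u⟩_{V′,V} ) dμ(u) = 0 for every nonnegative, nondecreasing, continuously differentiable real function ψ with bounded derivative; in particular μ is a Foias–Prodi stationary statistical solution. -/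
open MeasureTheory RealInnerProductSpace

/-- Expansion along the eigenfunctions. -/
theorem aux_expansion {H V : Type*}
    [NormedAddCommGroup H] [InnerProductSpace ℝ H]
    [NormedAddCommGroup V] [InnerProductSpace ℝ V] [CompleteSpace V]
    (L : V →L[ℝ] H) (v : ℕ → V)
    (heH : Orthonormal ℝ fun n => L (v n))
    (heV : ∀ i j : ℕ, i ≠ j → ⟪v i, v j⟫ = 0)
    (heSpan : Dense (Submodule.span ℝ (Set.range v) : Set V)) (u : V) :
    Filter.Tendsto (fun m => ∑ i : Fin m, ⟪L u, L (v i)⟫ • v i) Filter.atTop (nhds u) ∧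
    ∀ m, ‖∑ i : Fin m, ⟪L u, L (v i)⟫ • v i‖ ≤ ‖u‖ := by
  have hv0 : ∀ i, v i ≠ 0 := by
    intro i h
    have := heH.1 i
    simp [h] at this
  have hn0 : ∀ i, ‖v i‖ ≠ 0 := fun i => norm_ne_zero_iff.2 (hv0 i)
  have hon : Orthonormal ℝ (fun i => ‖v i‖⁻¹ • v i) := by
    refine ⟨fun i => ?_, fun i j hij => ?_⟩
    · rw [norm_smul, norm_inv, norm_norm, inv_mul_cancel₀ (hn0 i)]
    · simp [inner_smul_left, inner_smul_right, heV i j hij]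
  have hsp : ⊤ ≤ (Submodule.span ℝ (Set.range (fun i => ‖v i‖⁻¹ • v i))).topologicalClosure := by
    have h1 : Submodule.span ℝ (Set.range v) ≤
        Submodule.span ℝ (Set.range (fun i => ‖v i‖⁻¹ • v i)) := by
      rw [Submodule.span_le]
      rintro _ ⟨i, rfl⟩
      have h2 : v i = ‖v i‖ • (‖v i‖⁻¹ • v i) := by
        rw [smul_smul, mul_inv_cancel₀ (hn0 i), one_smul]
      rw [h2]
      exact Submodule.smul_mem _ _ (Submodule.subset_span ⟨i, rfl⟩)
    have h3 := Submodule.topologicalClosure_mono h1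
    rwa [(Submodule.dense_iff_topologicalClosure_eq_top).1 heSpan] at h3
  set b := HilbertBasis.mk hon hsp with hb
  have hbi : ∀ i, b i = ‖v i‖⁻¹ • v i := fun i => by simp [hb]
  have hs : HasSum (fun i => (b.repr u i * ‖v i‖⁻¹) • v i) u := by
    have := b.hasSum_repr u
    simpa [hbi, smul_smul] using this
  have hc : ∀ j, b.repr u j * ‖v j‖⁻¹ = ⟪L u, L (v j)⟫ := by
    intro j
    have h1 := (hs.mapL L).mapL (innerSL ℝ (L (v j)))
    have h2 : HasSum (fun i => innerSL ℝ (L (v j)) (L ((b.repr u i * ‖v i‖⁻¹) • v i)))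
        (b.repr u j * ‖v j‖⁻¹) := by
      have h3 := orthonormal_iff_ite.1 heH
      convert hasSum_ite_eq j (b.repr u j * ‖v j‖⁻¹) using 2 with i
      simp only [map_smul, innerSL_apply_apply, h3, smul_eq_mul]
      by_cases hij : i = j
      · simp [hij]
      · simp [hij, Ne.symm hij]
    have := h2.unique h1
    rw [this, innerSL_apply_apply, real_inner_comm]
  have hs' : HasSum (fun i => ⟪L u, L (v i)⟫ • v i) u := by
    simpa only [hc] using hs
  refine ⟨?_, fun m => ?_⟩
  · have := hs'.tendsto_sum_nat
    simpa only [Finset.sum_range] using this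
  · rw [← Finset.sum_range (fun i => ⟪L u, L (v i)⟫ • v i)]
    have e1 : ∀ i, ⟪L u, L (v i)⟫ • v i = ⟪b i, u⟫ • b i := by
      intro i
      rw [← hc, b.repr_apply_apply]
      conv_rhs => rw [hbi i, smul_smul, ← hbi i]
    simp only [e1]
    have hbo := b.orthonormal
    have h4 : ‖∑ i ∈ Finset.range m, ⟪b i, u⟫ • b i‖ ^ 2 ≤ ‖u‖ ^ 2 := by
      rw [← real_inner_self_eq_norm_sq, hbo.inner_sum]
      refine le_trans (le_of_eq ?_) (hbo.sum_inner_products_le u (s := Finset.range m))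
      refine Finset.sum_congr rfl fun i _ => ?_
      simp [sq]
    exact abs_le_of_sq_le_sq' h4 (norm_nonneg _) |>.2

/-- Bound for a bounded bilinear map. -/
theorem aux_bilin {V G : Type*} [NormedAddCommGroup V] [NormedSpace ℝ V]
    [NormedAddCommGroup G] [NormedSpace ℝ G] (B : V →L[ℝ] V →L[ℝ] G) :
    ∃ C : ℝ, 0 ≤ C ∧ ∀ u v, ‖B u v‖ ≤ C * ‖u‖ * ‖v‖ :=
  ⟨‖B‖, B.opNorm_nonneg, B.le_opNorm₂⟩

/-- Cut-off radial test function. -/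
theorem aux_test (m : ℕ) (R : ℝ) (hR : 0 < R) (ψ : ℝ → ℝ) (hψ : ContDiff ℝ 1 ψ) :
    ∃ Φ : (Fin m → ℝ) → ℝ, ContDiff ℝ 1 Φ ∧ HasCompactSupport Φ ∧
      ∀ y : Fin m → ℝ, (∀ i, |y i| ≤ R) → ∀ j,
        fderiv ℝ Φ y (Pi.single j 1) = deriv ψ (∑ i, y i ^ 2) * (2 * y j) := by
  let χ : ContDiffBump (0 : Fin m → ℝ) := ⟨R + 1, R + 2, by linarith, by linarith⟩
  have hq : ContDiff ℝ 1 (fun y : Fin m → ℝ => ψ (∑ i, y i ^ 2)) := by fun_prop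
  refine ⟨fun y => χ y * ψ (∑ i, y i ^ 2), χ.contDiff.mul hq, χ.hasCompactSupport.mul_right, ?_⟩
  intro y hy j
  have hyb : y ∈ Metric.ball (0 : Fin m → ℝ) (R + 1) := by
    rw [mem_ball_zero_iff]
    refine lt_of_le_of_lt ((pi_norm_le_iff_of_nonneg hR.le).2 ?_) (by linarith : R < R + 1)
    simpa using hy
  have hev : (fun y => χ y * ψ (∑ i, y i ^ 2)) =ᶠ[nhds y]
      (fun y : Fin m → ℝ => ψ (∑ i, y i ^ 2)) := by
    filter_upwards [χ.eventuallyEq_one_of_mem_ball hyb] with z hz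
    simp [hz]
  rw [hev.fderiv_eq]
  have hd : HasFDerivAt (fun y : Fin m → ℝ => ∑ i, y i ^ 2)
      (∑ i, (2 * y i) • (ContinuousLinearMap.proj i : (Fin m → ℝ) →L[ℝ] ℝ)) y := by
    refine HasFDerivAt.fun_sum fun i _ => ?_
    have := ((ContinuousLinearMap.proj i : (Fin m → ℝ) →L[ℝ] ℝ).hasFDerivAt (x := y)).pow 2
    simpa using this
  have hψd : HasDerivAt ψ (deriv ψ (∑ i, y i ^ 2)) (∑ i, y i ^ 2) :=
    (hψ.differentiable (by norm_num) _).hasDerivAt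
  have := hψd.comp_hasFDerivAt y hd
  rw [show (fun y : Fin m → ℝ => ψ (∑ i, y i ^ 2)) = ψ ∘ (fun y => ∑ i, y i ^ 2) from rfl,
    this.fderiv]
  simp [Pi.single_apply]

/-- Abstract functional setting of the 3D Navier–Stokes equations: `H` and `V` are the
usual (Hilbert) phase spaces with continuous dense inclusion `ιVH : V → H`, `W ⊆ V` is
the Banach space `D(A) ∩ W^{1,∞}` with continuous dense inclusion `ιWV : W → V`,
`A` is the Stokes operator (`⟨Au,v⟩ = (u,v)_V`), `Bop` the Navier–Stokes trilinear form
(with `⟨B(u,v),v⟩ = 0`), `f ∈ V′`, `ν > 0`, `F(u) = f − νAu − B(u,u)`, and `(e n)` the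
Stokes eigenfunctions, orthonormal in `H`, orthogonal in `V`, with dense span in `V`.
If `μ` is a weak stationary statistical solution carried by a bounded Borel set `B₀` of
`V`, then `μ` satisfies the mean energy equality
`∫ ψ′(‖u‖²_{L²}) (ν‖∇u‖² − ⟨f,u⟩) dμ = 0` for every nonnegative nondecreasing `C¹`
function `ψ` with bounded derivative; in particular `μ` has finite mean enstrophy and
is a Foias–Prodi stationary statistical solution (the stationarity identity holds for
all cylindrical test functionals over `V`). -/
theorem stmt19
    {H V W : Type*}
    [NormedAddCommGroup H] [InnerProductSpace ℝ H] [CompleteSpace H]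
    [NormedAddCommGroup V] [InnerProductSpace ℝ V] [CompleteSpace V]
    [MeasurableSpace V] [BorelSpace V] [SecondCountableTopology V]
    [NormedAddCommGroup W] [NormedSpace ℝ W] [CompleteSpace W]
    (ιVH : V →L[ℝ] H) (hVHinj : Function.Injective ιVH) (hVHdense : DenseRange ιVH)
    (ιWV : W →L[ℝ] V) (hWVinj : Function.Injective ιWV) (hWVdense : DenseRange ιWV)
    (ν : ℝ) (hν : 0 < ν) (f : V →L[ℝ] ℝ)
    (A : V →L[ℝ] V →L[ℝ] ℝ) (hA : ∀ u v : V, A u v = ⟪u, v⟫)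
    (Bop : V →L[ℝ] V →L[ℝ] V →L[ℝ] ℝ) (hBorth : ∀ u v : V, Bop u v v = 0)
    (F : V → V →L[ℝ] ℝ) (hF : ∀ u : V, F u = f - ν • A u - Bop u u)
    (e : ℕ → W)
    (heH : Orthonormal ℝ fun n => ιVH (ιWV (e n)))
    (heV : ∀ i j : ℕ, i ≠ j → ⟪ιWV (e i), ιWV (e j)⟫ = 0)
    (heSpan : Dense (Submodule.span ℝ (Set.range fun n => ιWV (e n)) : Set V))
    (B₀ : Set V) (hB₀m : MeasurableSet B₀) (hB₀b : Bornology.IsBounded B₀)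
    (μ : Measure V) [IsProbabilityMeasure μ] (hcar : μ B₀ᶜ = 0)
    (hwsss : ∀ (m : ℕ) (ψ : (Fin m → ℝ) → ℝ) (w : Fin m → W),
      ContDiff ℝ 1 ψ → HasCompactSupport ψ →
      ∫ u, F u (ιWV (∑ j, fderiv ℝ ψ
        (fun i => ⟪ιVH u, ιVH (ιWV (w i))⟫) (Pi.single j 1) • w j)) ∂μ = 0) :
    (∀ ψ : ℝ → ℝ, ContDiff ℝ 1 ψ → (∀ s, 0 ≤ ψ s) → Monotone ψ →
      (∃ M, ∀ s, |deriv ψ s| ≤ M) →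
      ∫ u, deriv ψ (‖ιVH u‖ ^ 2) * (ν * ‖u‖ ^ 2 - f u) ∂μ = 0) ∧
    Integrable (fun u : V => ‖u‖ ^ 2) μ ∧
    (∀ (m : ℕ) (ψ : (Fin m → ℝ) → ℝ) (w : Fin m → V),
      ContDiff ℝ 1 ψ → HasCompactSupport ψ →
      ∫ u, F u (∑ j, fderiv ℝ ψ
        (fun i => ⟪ιVH u, ιVH (w i)⟫) (Pi.single j 1) • w j) ∂μ = 0) := by
  classical
  obtain ⟨R, hR0, hR⟩ : ∃ R : ℝ, 0 < R ∧ ∀ u ∈ B₀, ‖u‖ ≤ R := hB₀b.exists_pos_norm_le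
  have hae : ∀ᵐ u ∂μ, ‖u‖ ≤ R := by
    have : ∀ᵐ u ∂μ, u ∈ B₀ := mem_ae_iff.2 hcar
    filter_upwards [this] with u hu using hR u hu
  have hFc : Continuous F := by
    have : F = fun u => f - ν • A u - Bop u u := funext hF
    rw [this]
    fun_prop
  obtain ⟨CB, hCB0, hCB⟩ := aux_bilin Bop
  obtain ⟨K, hK0, hK⟩ : ∃ K : ℝ, 0 ≤ K ∧ ∀ u : V, ‖u‖ ≤ R → ‖F u‖ ≤ K := by
    refine ⟨‖f‖ + ν * (‖A‖ * R) + CB * R * R, by positivity, fun u hu => ?_⟩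
    rw [hF]
    have h1 : ‖A u‖ ≤ ‖A‖ * R := (A.le_opNorm u).trans (by gcongr)
    have h2 : ‖Bop u u‖ ≤ CB * R * R := (hCB u u).trans (by gcongr)
    refine (norm_sub_le _ _).trans (add_le_add ((norm_sub_le _ _).trans (add_le_add le_rfl ?_)) h2)
    rw [norm_smul, Real.norm_of_nonneg hν.le]
    gcongr
  refine ⟨?_, ?_, ?_⟩
  · intro ψ hψ _ _ hM
    obtain ⟨M, hM⟩ := hM
    have hM0 : 0 ≤ M := (abs_nonneg _).trans (hM 0)
    have hψc : Continuous (deriv ψ) := hψ.continuous_deriv le_rfl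
    let P : ℕ → V → V := fun m u =>
      ∑ i : Fin m, ⟪ιVH u, ιVH (ιWV (e i))⟫ • ιWV (e i)
    have hexp := aux_expansion ιVH (fun n => ιWV (e n)) heH heV heSpan
    have hPt : ∀ u, Filter.Tendsto (fun m => P m u) Filter.atTop (nhds u) := fun u => (hexp u).1
    have hPb : ∀ u m, ‖P m u‖ ≤ ‖u‖ := fun u => (hexp u).2
    have hPc : ∀ m, Continuous (P m) := by
      intro m
      show Continuous fun u => ∑ i : Fin m, ⟪ιVH u, ιVH (ιWV (e i))⟫ • ιWV (e i)
      fun_prop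
    have hPi : ∀ m u, ⟪ιVH u, ιVH (P m u)⟫ = ∑ i : Fin m, ⟪ιVH u, ιVH (ιWV (e i))⟫ ^ 2 := by
      intro m u
      simp [P, inner_sum, inner_smul_right, sq]
    have hzero : ∀ m, ∫ u, deriv ψ (⟪ιVH u, ιVH (P m u)⟫) * F u (P m u) ∂μ = 0 := by
      intro m
      obtain ⟨Φ, hΦ1, hΦ2, hΦ3⟩ := aux_test m (‖ιVH‖ * R + 1) (by positivity) ψ hψ
      have h := hwsss m Φ (fun i => e i) hΦ1 hΦ2
      have h2 : ∫ u, 2 * (deriv ψ (⟪ιVH u, ιVH (P m u)⟫) * F u (P m u)) ∂μ = 0 := by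
        rw [← h]
        refine integral_congr_ae ?_
        filter_upwards [hae] with u hu
        have hy : ∀ i : Fin m, |⟪ιVH u, ιVH (ιWV (e i))⟫| ≤ ‖ιVH‖ * R + 1 := by
          intro i
          refine (abs_real_inner_le_norm _ _).trans ?_
          have h1 : ‖ιVH (ιWV (e i))‖ = 1 := heH.1 i
          rw [h1, mul_one]
          have h3 : ‖ιVH u‖ ≤ ‖ιVH‖ * R := (ιVH.le_opNorm u).trans (by gcongr)
          linarith
        have h5 := hΦ3 (fun i : Fin m => ⟪ιVH u, ιVH (ιWV (e i))⟫) hy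
        simp only [h5, hPi]
        simp only [P, map_sum, map_smul, smul_eq_mul, Finset.mul_sum]
        refine Finset.sum_congr rfl fun i _ => ?_
        ring
      rw [integral_const_mul] at h2
      linarith
    have hFP : ∀ u, F u u = -(ν * ‖u‖ ^ 2 - f u) := by
      intro u
      rw [hF]
      simp [hA, hBorth]
    have hlim : Filter.Tendsto
        (fun m => ∫ u, deriv ψ (⟪ιVH u, ιVH (P m u)⟫) * F u (P m u) ∂μ) Filter.atTop
        (nhds (∫ u, deriv ψ (‖ιVH u‖ ^ 2) * F u u ∂μ)) := by
      refine tendsto_integral_of_dominated_convergence (fun _ => M * (K * R)) ?_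
        (integrable_const _) ?_ ?_
      · intro m
        have := hPc m
        refine Continuous.aestronglyMeasurable ?_
        exact (hψc.comp (by fun_prop)).mul (hFc.clm_apply this)
      · intro m
        filter_upwards [hae] with u hu
        rw [norm_mul]
        refine mul_le_mul (hM _) ?_ (norm_nonneg _) hM0
        refine ((F u).le_opNorm _).trans ?_
        exact mul_le_mul (hK u hu) ((hPb u m).trans hu) (norm_nonneg _) hK0
      · refine Filter.Eventually.of_forall fun u => ?_
        refine Filter.Tendsto.mul ?_ (((F u).continuous.tendsto u).comp (hPt u))
        rw [← real_inner_self_eq_norm_sq]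
        have hc : Continuous fun x => deriv ψ (⟪ιVH u, ιVH x⟫) := hψc.comp (by fun_prop)
        exact (hc.tendsto u).comp (hPt u)
    simp only [hzero] at hlim
    have h0 := tendsto_nhds_unique hlim tendsto_const_nhds
    simp only [hFP, mul_neg, integral_neg] at h0
    linarith
  · refine Integrable.of_bound (C := R ^ 2) (by fun_prop) ?_
    filter_upwards [hae] with u hu
    rw [norm_pow, norm_norm]
    gcongr
  · intro m ψ w hψ hψs
    have hseq : ∀ j, ∃ x : ℕ → W, Filter.Tendsto (fun k => ιWV (x k)) Filter.atTop (nhds (w j)) := by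
      intro j
      obtain ⟨y, hy, hyl⟩ := mem_closure_iff_seq_limit.1 (hWVdense (w j))
      choose x hx using hy
      exact ⟨x, by simpa only [hx] using hyl⟩
    choose x hx using hseq
    have hfc : Continuous (fderiv ℝ ψ) := hψ.continuous_fderiv (by norm_num)
    obtain ⟨C, hC⟩ := (hψs.fderiv (𝕜 := ℝ)).exists_bound_of_continuous hfc
    have hC0 : 0 ≤ C := (norm_nonneg _).trans (hC 0)
    have hbd : ∀ j, ∃ D, ∀ k, ‖ιWV (x j k)‖ ≤ D := by
      intro j
      obtain ⟨D, hD⟩ := (Metric.isBounded_range_of_tendsto _ (hx j)).exists_norm_le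
      exact ⟨D, fun k => hD _ ⟨k, rfl⟩⟩
    choose D hD using hbd
    have hlim : Filter.Tendsto
        (fun k => ∫ u, F u (∑ j, fderiv ℝ ψ
          (fun i => ⟪ιVH u, ιVH (ιWV (x i k))⟫) (Pi.single j 1) • ιWV (x j k)) ∂μ) Filter.atTop
        (nhds (∫ u, F u (∑ j, fderiv ℝ ψ
          (fun i => ⟪ιVH u, ιVH (w i)⟫) (Pi.single j 1) • w j) ∂μ)) := by
      refine tendsto_integral_of_dominated_convergence
        (fun _ => K * ∑ j, C * ‖(Pi.single j 1 : Fin m → ℝ)‖ * D j) ?_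
        (integrable_const _) ?_ ?_
      · intro k
        refine Continuous.aestronglyMeasurable ?_
        refine hFc.clm_apply (continuous_finsetSum _ fun j _ => ?_)
        exact ((hfc.comp (by fun_prop)).clm_apply continuous_const).smul continuous_const
      · intro k
        filter_upwards [hae] with u hu
        refine ((F u).le_opNorm _).trans ?_
        refine mul_le_mul (hK u hu) ?_ (norm_nonneg _) hK0
        refine (norm_sum_le _ _).trans (Finset.sum_le_sum fun j _ => ?_)
        rw [norm_smul]
        refine mul_le_mul ?_ (hD j k) (norm_nonneg _) (by positivity)
        exact (ContinuousLinearMap.le_opNorm _ _).trans (by gcongr; exact hC _)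
      · refine Filter.Eventually.of_forall fun u => ?_
        have hc : Continuous fun z : Fin m → V => F u (∑ j, fderiv ℝ ψ
            (fun i => ⟪ιVH u, ιVH (z i)⟫) (Pi.single j 1) • z j) := by
          refine (F u).continuous.comp (continuous_finsetSum _ fun j _ => ?_)
          exact ((hfc.comp (by fun_prop)).clm_apply continuous_const).smul (continuous_apply j)
        have ht : Filter.Tendsto (fun k => fun j => ιWV (x j k)) Filter.atTop (nhds w) :=
          tendsto_pi_nhds.2 hx
        exact (hc.tendsto w).comp ht
    have hz : ∀ k, ∫ u, F u (∑ j, fderiv ℝ ψ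
          (fun i => ⟪ιVH u, ιVH (ιWV (x i k))⟫) (Pi.single j 1) • ιWV (x j k)) ∂μ = 0 := by
      intro k
      have := hwsss m ψ (fun i => x i k) hψ hψs
      simpa only [map_sum, map_smul] using this
    simp only [hz] at hlim
    exact tendsto_nhds_unique hlim tendsto_const_nhds
end
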